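/- Let $k=1$ and let $z_1,\dots,z_n$ be pairwise distinct real numbers, and set $Q(z_1,\dots,z_n) = -\tfrac12 \sum_{1\le i<j\le n} \ln|z_i - z_j|\,(z_i-z_j)^2$. Then for all $i, j, m \in \{1,\dots,n\}$, $\big(\bar H_m(z_1,\dots,z_n)\,v_{\{i\}},\;v_{\{j\}}\big) = \dfrac{\partial^3 Q}{\partial z_i\,\partial z_j\,\partial z_m}(z_1,\dots,z_n)$. -/

import Mathlib

noncomputable section

/-- The `sl₂`-module `W^{⊗n}`, `W = ℂ²`, identified with the free complex vector space
on the set of subsets of `{1,…,n}`. -/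
abbrev WT (n : ℕ) := Finset (Fin n) →₀ ℂ

/-- Build a linear operator on `WT n` from its values on the basis vectors `V_I`. -/
def mkOp {n : ℕ} (φ : Finset (Fin n) → WT n) : WT n →ₗ[ℂ] WT n :=
  Finsupp.lsum ℂ fun I => LinearMap.toSpanSingleton ℂ (WT n) (φ I)

/-- Diagonal action of `e`: `e V_I = ∑_{i ∈ I} V_{I∖{i}}`. -/
def opE (n : ℕ) : WT n →ₗ[ℂ] WT n :=
  mkOp fun I => ∑ i ∈ I, Finsupp.single (I.erase i) 1

/-- Diagonal action of `f`: `f V_I = ∑_{i ∉ I} V_{I∪{i}}`. -/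
def opF (n : ℕ) : WT n →ₗ[ℂ] WT n :=
  mkOp fun I => ∑ i ∈ Iᶜ, Finsupp.single (insert i I) 1

/-- Diagonal action of `h`: `h V_I = (n - 2|I|) V_I`. -/
def opH (n : ℕ) : WT n →ₗ[ℂ] WT n :=
  mkOp fun I => ((n : ℂ) - 2 * I.card) • Finsupp.single I 1

/-- The Shapovalov form: the symmetric bilinear form with `(V_I, V_J) = δ_{IJ}`. -/
def shap {n : ℕ} (x y : WT n) : ℂ := x.sum fun I c => c * y I

/-- The weight space `W^{⊗n}[n-2k]`, spanned by the `V_I` with `|I| = k`. -/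
def weight (n k : ℕ) : Submodule ℂ (WT n) :=
  Submodule.span ℂ {x | ∃ I : Finset (Fin n), I.card = k ∧ x = Finsupp.single I 1}

/-- The space of singular vectors `Sing W^{⊗n}[n-2k] = {w ∈ W^{⊗n}[n-2k] : e w = 0}`. -/
def sing (n k : ℕ) : Submodule ℂ (WT n) :=
  weight n k ⊓ LinearMap.ker (opE n)

/-- Action of `e` in the `i`-th tensor factor. -/
def eAt {n : ℕ} (i : Fin n) : WT n →ₗ[ℂ] WT n :=
  mkOp fun I => if i ∈ I then Finsupp.single (I.erase i) 1 else 0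

/-- Action of `f` in the `i`-th tensor factor. -/
def fAt {n : ℕ} (i : Fin n) : WT n →ₗ[ℂ] WT n :=
  mkOp fun I => if i ∈ I then 0 else Finsupp.single (insert i I) 1

/-- Action of `h` in the `i`-th tensor factor. -/
def hAt {n : ℕ} (i : Fin n) : WT n →ₗ[ℂ] WT n :=
  mkOp fun I => (if i ∈ I then (-1 : ℂ) else 1) • Finsupp.single I 1

/-- The Casimir operator `Ω = ½ h⊗h + e⊗f + f⊗e` acting in the `m`-th and `j`-th
tensor factors of `W^{⊗n}`. -/
def Omega {n : ℕ} (m j : Fin n) : WT n →ₗ[ℂ] WT n :=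
  (2⁻¹ : ℂ) • (hAt m ∘ₗ hAt j) + eAt m ∘ₗ fAt j + fAt m ∘ₗ eAt j

/-- The reduced Casimir operator `Ω̄ = Ω - ½` acting in the `m`-th and `j`-th factors. -/
def OmegaBar {n : ℕ} (m j : Fin n) : WT n →ₗ[ℂ] WT n :=
  Omega m j - (2⁻¹ : ℂ) • LinearMap.id

/-- The Gaudin Hamiltonian `H_m(u) = ∑_{j ≠ m} Ω_{mj} / (u_m - u_j)`. -/
def gaudin {n : ℕ} (u : Fin n → ℂ) (m : Fin n) : WT n →ₗ[ℂ] WT n :=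
  ∑ j ∈ Finset.univ.erase m, (u m - u j)⁻¹ • Omega m j

/-- The reduced Gaudin Hamiltonian `H̄_m(u) = ∑_{j ≠ m} Ω̄_{mj} / (u_m - u_j)`. -/
def gaudinBar {n : ℕ} (u : Fin n → ℂ) (m : Fin n) : WT n →ₗ[ℂ] WT n :=
  ∑ j ∈ Finset.univ.erase m, (u m - u j)⁻¹ • OmegaBar m j

/-- Partial derivative of a function of `z : Fin n → ℝ` with respect to `z_v`. -/
def pd1 {n : ℕ} (v : Fin n) (f : (Fin n → ℝ) → ℝ) : (Fin n → ℝ) → ℝ :=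
  fun x => fderiv ℝ f x (Pi.single v 1)

/-- For `k = 1`, the projected vector
`v_{i} = (n-1)/n V_{i} - (1/n) ∑_{j ≠ i} V_{j}`. -/
def vOne (n : ℕ) (i : Fin n) : WT n :=
  (((n : ℂ) - 1) / n) • Finsupp.single {i} 1 -
    (n : ℂ)⁻¹ • ∑ j ∈ ({i}ᶜ : Finset (Fin n)), Finsupp.single {j} 1

/-- For `k = 1`, the potential of the second kind
`Q(z) = -½ ∑_{i<j} ln|z_i - z_j| (z_i - z_j)²`. -/
def Qone (n : ℕ) : (Fin n → ℝ) → ℝ := fun z =>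
  (-1 / 2) *
    ∑ p ∈ Finset.univ.filter (fun p : Fin n × Fin n => p.1 < p.2),
      Real.log |z p.1 - z p.2| * (z p.1 - z p.2) ^ 2

@[simp]
theorem mkOp_single {n : ℕ} (φ : Finset (Fin n) → WT n) (I : Finset (Fin n)) :
    mkOp φ (Finsupp.single I 1) = φ I := by
  simp [mkOp]

/-- The difference `δ_{va} - δ_{vb}`, which is also `∂(z_a - z_b)/∂z_v`. -/
def deltaDiff {n : ℕ} (v a b : Fin n) : ℝ :=
  (if v = a then 1 else 0) - (if v = b then 1 else 0)

theorem deltaDiff_swap {n : ℕ} (v a b : Fin n) : deltaDiff v b a = -deltaDiff v a b := by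
  simp [deltaDiff]

theorem sum_deltaDiff {n : ℕ} (a b : Fin n) : ∑ v, deltaDiff v a b = 0 := by
  simp [deltaDiff]

/-- On the weight space spanned by the `V_{a}`, the operator `Ω̄_{ml}` has rank one. -/
theorem OmegaBar_single {n : ℕ} {m l : Fin n} (hml : m ≠ l) (a : Fin n) :
    OmegaBar m l (Finsupp.single {a} 1) =
      (deltaDiff a m l : ℂ) • (Finsupp.single {l} 1 - Finsupp.single {m} 1 : WT n) := by
  simp only [OmegaBar, Omega, deltaDiff, eAt, fAt, hAt, LinearMap.sub_apply, LinearMap.add_apply,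
    LinearMap.smul_apply, LinearMap.comp_apply, mkOp_single, LinearMap.id_apply,
    Finset.mem_singleton, map_smul]
  by_cases hm : m = a
  · subst hm
    have h1 : ({l, m} : Finset (Fin n)).erase m = {l} := by
      ext x; simp only [Finset.mem_erase, Finset.mem_insert, Finset.mem_singleton]; grind
    simp only [hml, hml.symm, if_true, if_false, mkOp_single, Finset.mem_insert,
      Finset.mem_singleton, or_true, h1, map_zero]
    push_cast
    module
  · by_cases hl : l = a
    · subst hl
      simp only [hml, hml.symm, if_true, if_false, mkOp_single,
        Finset.erase_singleton, Finset.notMem_empty, insert_empty_eq, map_zero]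
      push_cast
      module
    · simp [hm, hl, Ne.symm hm, Ne.symm hl, hml]

theorem vOne_eq {n : ℕ} (i : Fin n) :
    vOne n i = Finsupp.single {i} 1 - (n : ℂ)⁻¹ • ∑ a : Fin n, Finsupp.single {a} 1 := by
  have hn : (n : ℂ) ≠ 0 := by
    have := i.pos
    exact_mod_cast this.ne'
  rw [vOne, Fintype.sum_eq_add_sum_compl i, sub_div, div_self hn]
  module

theorem OmegaBar_vOne {n : ℕ} {m l : Fin n} (hml : m ≠ l) (i : Fin n) :
    OmegaBar m l (vOne n i) =
      (deltaDiff i m l : ℂ) • (Finsupp.single {l} 1 - Finsupp.single {m} 1 : WT n) := by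
  have h : ∑ a : Fin n, (deltaDiff a m l : ℂ) = 0 := by exact_mod_cast sum_deltaDiff m l
  simp only [vOne_eq, map_sub, map_smul, map_sum, OmegaBar_single hml, ← Finset.sum_smul, h]
  simp

theorem shap_eq_sum {n : ℕ} (x y : WT n) : shap x y = ∑ I, x I * y I :=
  Finsupp.sum_fintype _ _ (by simp)

theorem vOne_apply_sub {n : ℕ} (j m l : Fin n) :
    vOne n j {l} - vOne n j {m} = -(deltaDiff j m l : ℂ) := by
  simp [vOne_eq, Finsupp.single_apply, deltaDiff, apply_ite Complex.ofReal]

theorem shap_gaudinBar_vOne {n : ℕ} (u : Fin n → ℂ) (i j m : Fin n) :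
    shap (gaudinBar u m (vOne n i)) (vOne n j) =
      -∑ l ∈ Finset.univ.erase m,
        (deltaDiff i m l : ℂ) * (deltaDiff j m l : ℂ) * (u m - u l)⁻¹ := by
  have key : ∀ l ∈ Finset.univ.erase m, ∑ I, ((u m - u l)⁻¹ • OmegaBar m l (vOne n i)) I *
      vOne n j I = -((deltaDiff i m l : ℂ) * (deltaDiff j m l : ℂ) * (u m - u l)⁻¹) := by
    intro l hl
    rw [OmegaBar_vOne (Finset.ne_of_mem_erase hl).symm]
    have h : ∑ I, (Finsupp.single {l} 1 - Finsupp.single {m} 1 : WT n) I * vOne n j I =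
        -(deltaDiff j m l : ℂ) := by
      rw [← vOne_apply_sub]
      simp [sub_mul, Finsupp.single_apply]
    simp only [Finsupp.smul_apply, smul_eq_mul, mul_assoc, ← Finset.mul_sum, h]
    ring
  rw [shap_eq_sum, gaudinBar, ← Finset.sum_neg_distrib, ← Finset.sum_congr rfl key,
    Finset.sum_comm]
  simp [LinearMap.sum_apply, Finsupp.finsetSum_apply, Finset.sum_mul]

/-- Partial derivatives of a sum of functions of the differences `x_a - x_b`. -/
theorem pd1_sum_of_differences {n : ℕ} (P : Finset (Fin n × Fin n)) (c : Fin n × Fin n → ℝ)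
    {G G' : ℝ → ℝ} (hG : ∀ t ≠ 0, HasDerivAt G (G' t) t) {f : (Fin n → ℝ) → ℝ}
    (hf : ∀ x : Fin n → ℝ, (∀ p ∈ P, x p.1 - x p.2 ≠ 0) →
      f x = ∑ p ∈ P, c p * G (x p.1 - x p.2))
    (v : Fin n) (x : Fin n → ℝ) (hx : ∀ p ∈ P, x p.1 - x p.2 ≠ 0) :
    pd1 v f x = ∑ p ∈ P, c p * deltaDiff v p.1 p.2 * G' (x p.1 - x p.2) := by
  have hnear : ∀ᶠ y in nhds x, ∀ p ∈ P, y p.1 - y p.2 ≠ 0 := by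
    rw [Filter.eventually_all_finset]
    intro p hp
    exact ContinuousAt.eventually_ne (by fun_prop) (hx p hp)
  have hfG : f =ᶠ[nhds x] fun y => ∑ p ∈ P, c p * G (y p.1 - y p.2) := hnear.mono hf
  have hD : HasFDerivAt (fun y : Fin n → ℝ => ∑ p ∈ P, c p * G (y p.1 - y p.2))
      (∑ p ∈ P, c p • (G' (x p.1 - x p.2) •
        (ContinuousLinearMap.proj (R := ℝ) (φ := fun _ : Fin n => ℝ) p.1 -
          ContinuousLinearMap.proj p.2))) x := by
    refine HasFDerivAt.fun_sum fun p hp => HasFDerivAt.const_mul ?_ _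
    exact (hG _ (hx p hp)).comp_hasFDerivAt x
      ((hasFDerivAt_apply p.1 x).sub (hasFDerivAt_apply p.2 x))
  rw [pd1, hfG.fderiv_eq, hD.fderiv]
  simp only [sum_apply, smul_apply, sub_apply, ContinuousLinearMap.proj_apply, smul_eq_mul, Pi.single_apply,
    deltaDiff, @eq_comm _ v]
  exact Finset.sum_congr rfl fun p _ => by ring

theorem hasDerivAt_log_abs_mul_sq {t : ℝ} (ht : t ≠ 0) :
    HasDerivAt (fun t : ℝ => Real.log |t| * t ^ 2) (2 * t * Real.log t + t) t := by
  simp only [Real.log_abs]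
  refine ((Real.hasDerivAt_log ht).fun_mul (hasDerivAt_pow 2 t)).congr_deriv ?_
  field_simp
  push_cast
  ring

theorem hasDerivAt_two_mul_mul_log_add {t : ℝ} (ht : t ≠ 0) :
    HasDerivAt (fun t : ℝ => 2 * t * Real.log t + t) (2 * Real.log t + 3) t := by
  refine ((((hasDerivAt_id' t).const_mul 2).fun_mul (Real.hasDerivAt_log ht)).fun_add
    (hasDerivAt_id' t)).congr_deriv ?_
  field_simp
  ring

theorem hasDerivAt_two_mul_log_add {t : ℝ} (ht : t ≠ 0) :
    HasDerivAt (fun t : ℝ => 2 * Real.log t + 3) (2 * t⁻¹) t :=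
  ((Real.hasDerivAt_log ht).const_mul 2).add_const 3

theorem pd1_pd1_pd1_Qone {n : ℕ} {z : Fin n → ℝ} (hz : Function.Injective z) (i j m : Fin n) :
    pd1 m (pd1 j (pd1 i (Qone n))) z =
      ∑ p ∈ Finset.univ.filter (fun p : Fin n × Fin n => p.1 < p.2),
        -1 / 2 * deltaDiff i p.1 p.2 * deltaDiff j p.1 p.2 * deltaDiff m p.1 p.2 *
          (2 * (z p.1 - z p.2)⁻¹) := by
  have hQ : ∀ x : Fin n → ℝ,
      (∀ p ∈ Finset.univ.filter (fun p : Fin n × Fin n => p.1 < p.2), x p.1 - x p.2 ≠ 0) →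
      Qone n x = ∑ p ∈ Finset.univ.filter (fun p : Fin n × Fin n => p.1 < p.2),
        -1 / 2 * (fun t : ℝ => Real.log |t| * t ^ 2) (x p.1 - x p.2) :=
    fun x _ => Finset.mul_sum _ _ _
  refine pd1_sum_of_differences _ _ (fun t => hasDerivAt_two_mul_log_add)
    (pd1_sum_of_differences _ _ (fun t => hasDerivAt_two_mul_mul_log_add)
      (pd1_sum_of_differences _ _ (fun t => hasDerivAt_log_abs_mul_sq) hQ i) j) m z ?_
  intro p hp
  exact sub_ne_zero.2 (hz.ne (Finset.mem_filter.1 hp).2.ne)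

/-- For antisymmetric `K`, a sum over ordered pairs weighted by `δ_{ma} - δ_{mb}` reduces to
the pairs whose first entry is `m`. -/
theorem sum_lt_deltaDiff_mul {n : ℕ} {K : Fin n → Fin n → ℝ} (hK : ∀ a b, K b a = -K a b)
    (m : Fin n) :
    ∑ p ∈ Finset.univ.filter (fun p : Fin n × Fin n => p.1 < p.2),
        deltaDiff m p.1 p.2 * K p.1 p.2 = ∑ l ∈ Finset.univ.erase m, K m l := by
  have hsplit : ∀ a b : Fin n, (if a < b then deltaDiff m a b * K a b else 0) =
      (if m = a then if m < b then K m b else 0 else 0) +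
        (if m = b then if a < m then K m a else 0 else 0) := by
    intro a b
    have := hK a b
    unfold deltaDiff
    split_ifs <;> grind
  rw [Finset.sum_filter, Fintype.sum_prod_type]
  simp only [hsplit, Finset.sum_add_distrib, Finset.sum_ite_eq, Finset.mem_univ, if_true]
  rw [Finset.sum_comm]
  simp only [Finset.sum_ite_eq, Finset.mem_univ, if_true]
  rw [← Finset.sum_add_distrib, ← Finset.filter_ne, Finset.sum_filter]
  refine Finset.sum_congr rfl fun l _ => ?_
  rcases lt_trichotomy m l with h | h | h
  · simp [h, h.ne, h.not_gt]
  · simp [h]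
  · simp [h, h.ne', h.not_gt]

/-- for `k = 1` and pairwise distinct real `z₁,…,z_n`,
`(H̄_m(z) v_{i}, v_{j}) = ∂³Q/∂z_i ∂z_j ∂z_m (z)`. -/
theorem stmt14 (n : ℕ) (hn : 2 ≤ n) (z : Fin n → ℝ) (hz : Function.Injective z)
    (i j m : Fin n) :
    shap (gaudinBar (fun a : Fin n => ((z a : ℝ) : ℂ)) m (vOne n i)) (vOne n j) =
      ((pd1 m (pd1 j (pd1 i (Qone n))) z : ℝ) : ℂ) := by
  rw [shap_gaudinBar_vOne, pd1_pd1_pd1_Qone hz]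
  have hsum := sum_lt_deltaDiff_mul (m := m)
    (K := fun a b => -(deltaDiff i a b * deltaDiff j a b * (z a - z b)⁻¹)) (fun a b => by
      rw [deltaDiff_swap i, deltaDiff_swap j, ← neg_sub (z a), inv_neg]
      ring)
  rw [Finset.sum_congr rfl (g := fun p : Fin n × Fin n => deltaDiff m p.1 p.2 *
    -(deltaDiff i p.1 p.2 * deltaDiff j p.1 p.2 * (z p.1 - z p.2)⁻¹)) fun p _ => by ring, hsum]
  push_cast
  rw [Finset.sum_neg_distrib]
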